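/- Let a_n denote the number of permutations of length n avoiding both 4321 and 1324, with a_0 = 1. Then, as formal power series over the integers, (1−x)¹² · ∑_{n≥0} a_n xⁿ = 1 − 11x + 56x² − 172x³ + 357x⁴ − 519x⁵ + 554x⁶ − 413x⁷ + 217x⁸ − 83x⁹ + 20x¹⁰ − 2x¹¹. -/

import Mathlib

/-- A list of naturals is a permutation (in one-line notation) of `1,…,n`
where `n` is its length. -/
def IsPermList (l : List ℕ) : Prop :=
  l.Perm ((List.range l.length).map (· + 1))

/-- `f` is an occurrence of the pattern `β` in `π`: a strictly increasing
choice of indices of `π` whose entries are order isomorphic to `β`. -/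
def IsOccurrence (π β : List ℕ) (f : Fin β.length → Fin π.length) : Prop :=
  StrictMono f ∧ ∀ s t : Fin β.length, π.get (f s) < π.get (f t) ↔ β.get s < β.get t

/-- `π` contains the pattern `β`. -/
def PContains (π β : List ℕ) : Prop :=
  ∃ f : Fin β.length → Fin π.length, IsOccurrence π β f

/-- `π` avoids the pattern `β`. -/
def PAvoids (π β : List ℕ) : Prop :=
  ¬ PContains π β

/-- The class of permutations avoiding every member of `B`. -/
def Av (B : Set (List ℕ)) : Set (List ℕ) :=
  {π | IsPermList π ∧ ∀ β ∈ B, PAvoids π β}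

/-- Insert a new maximum entry at (0-indexed) position `i` of `l`. -/
def insertMax (l : List ℕ) (i : ℕ) : List ℕ :=
  l.insertIdx i (l.length + 1)

/-- Position `i` is an active site of `l` relative to `B`. -/
def ActiveSite (B : Set (List ℕ)) (l : List ℕ) (i : ℕ) : Prop :=
  i ≤ l.length ∧ insertMax l i ∈ Av B

/-- The increasing permutation `1,2,…,n`. -/
def incrPerm (n : ℕ) : List ℕ :=
  (List.range n).map (· + 1)

/-- A permutation (as a list) is a vertical alternation: every entry in an even
(1-indexed) position lies above every entry in an odd position, or vice versa.
(Index `s : Fin l.length` corresponds to 1-indexed position `s + 1`.) -/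
def VerticalAlternation (l : List ℕ) : Prop :=
  (∀ s t : Fin l.length, s.val % 2 = 1 → t.val % 2 = 0 → l.get t < l.get s) ∨
  (∀ s t : Fin l.length, s.val % 2 = 1 → t.val % 2 = 0 → l.get s < l.get t)

/-- The subsequence of entries in positions congruent to `r` (0-indexed, mod 2)
is increasing. -/
def IncOnRes (l : List ℕ) (r : ℕ) : Prop :=
  ∀ s t : Fin l.length, s < t → s.val % 2 = r → t.val % 2 = r → l.get s < l.get t

/-- The subsequence of entries in positions congruent to `r` (0-indexed, mod 2)
is decreasing. -/
def DecOnRes (l : List ℕ) (r : ℕ) : Prop :=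
  ∀ s t : Fin l.length, s < t → s.val % 2 = r → t.val % 2 = r → l.get t < l.get s

/-- A vertical parallel alternation: a vertical alternation of even length whose
odd-position and even-position subsequences are both increasing or both decreasing. -/
def IsVertParallel (l : List ℕ) : Prop :=
  VerticalAlternation l ∧ Even l.length ∧
    ((IncOnRes l 0 ∧ IncOnRes l 1) ∨ (DecOnRes l 0 ∧ DecOnRes l 1))

/-- A vertical wedge alternation: a vertical alternation of even length for which one of
the odd-position and even-position subsequences is increasing and the other decreasing. -/
def IsVertWedge (l : List ℕ) : Prop :=
  VerticalAlternation l ∧ Even l.length ∧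
    ((IncOnRes l 0 ∧ DecOnRes l 1) ∨ (DecOnRes l 0 ∧ IncOnRes l 1))

/-- The vertical parallel alternation `σ_m`, with `σ_m(2i−1) = m+1−i` and
`σ_m(2i) = 2m+1−i` (1-indexed). -/
def sigmaAlt (m : ℕ) : List ℕ :=
  (List.range (2 * m)).map (fun j => if j % 2 = 0 then m - j / 2 else 2 * m - j / 2)

/-- The vertical wedge alternation `τ_m`, with `τ_m(2i−1) = m+i` and
`τ_m(2i) = m+1−i` (1-indexed). -/
def tauAlt (m : ℕ) : List ℕ :=
  (List.range (2 * m)).map (fun j => if j % 2 = 0 then m + j / 2 + 1 else m - j / 2)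

/-- Standardization: replace each entry of `l` by its rank among the entries of `l`. -/
def stList (l : List ℕ) : List ℕ :=
  l.map (fun x => (l.filter (fun y => y ≤ x)).length)

/-- The number whose binary digits below `2 ^ n` are given by `f`. -/
def bitMask (n : ℕ) (f : ℕ → Bool) : ℕ :=
  Nat.rec 0 (fun i m => m ||| (f i).toNat <<< i) n

/-- What a prefix of a permutation imposes on the entries still to come. The values not yet used
form `size` nonempty slots, separated by values of the prefix. Slot `i` lies above (below) some
entry of the prefix iff bit `i` of `above` (`below`) is set, and below the lower entry of some
descent of the prefix iff bit `i` of `desc` is set. Bit `i * size + j` of `asc` is set iff the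
prefix contains an ascent `u … v` with `u` below slot `i`, and `v` between slots `i` and `j`. -/
structure SlotState where
  size : ℕ
  above : ℕ
  below : ℕ
  desc : ℕ
  asc : ℕ
deriving DecidableEq

namespace SlotState

/-- `S.ascBit i j` reads off the matrix stored in `S.asc`. -/
def ascBit (S : SlotState) (i j : ℕ) : Bool :=
  S.asc.testBit (i * S.size + j)

/-- An entry taken from slot `k` (with further values below it in the same slot if `lo`) does not
force an occurrence of 1324 or 4321. -/
def ok (S : SlotState) (k : ℕ) (lo : Bool) : Bool :=
  (List.range S.size).all (fun j => !S.ascBit k j) && (!S.desc.testBit k || (k == 0 && !lo))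

/-- The slot from which the new slot `i` stems when an entry of slot `k` is read. -/
def origin (k : ℕ) (lo hi : Bool) (i : ℕ) : ℕ :=
  if i < k + lo.toNat then i else i + 1 - (lo.toNat + hi.toNat)

/-- The state after reading an entry of slot `k`; `lo` and `hi` tell whether this slot contains
values below and above that entry. -/
def step (S : SlotState) (k : ℕ) (lo hi : Bool) : SlotState :=
  let t := S.size - 1 + lo.toNat + hi.toNat
  let o := origin k lo hi
  let b := fun i => decide (i < k + lo.toNat)
  { size := t
    above := bitMask t fun i => S.above.testBit (o i) || !b i
    below := bitMask t fun i => S.below.testBit (o i) || b i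
    desc := bitMask t fun i => S.desc.testBit (o i) || (S.below.testBit k && b i)
    asc := bitMask (t * t) fun x => S.ascBit (o (x / t)) (o (x % t)) ||
      (S.above.testBit (o (x / t)) && b (x / t) && !b (x % t)) }

/-- The states reachable from `S` by reading one entry. -/
def succs (S : SlotState) : List SlotState :=
  (List.range S.size).flatMap fun k =>
    [(false, false), (false, true), (true, false), (true, true)].flatMap fun p =>
      if S.ok k p.1 then [S.step k p.1 p.2] else []

/-- Any way to fill the slots of `S` creates an occurrence of 4321. -/
def dead (S : SlotState) : Bool :=
  let r := List.range S.size
  let a := fun i j => decide (i < j) && S.ascBit i j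
  r.any fun g => r.any fun h => a g h &&
    (S.desc.testBit h || r.any fun i => a h i && (S.below.testBit i || r.any fun j => a i j))

end SlotState

/-- Coefficientwise sum of coefficient lists. -/
def addCoeffs : List ℤ → List ℤ → List ℤ
  | [], m => m
  | l, [] => l
  | a :: l, b :: m => (a + b) :: addCoeffs l m

set_option maxHeartbeats 2000000 in
/-- The states reachable without passing through dead ones, each with the numerator of its
generating function over the denominator `(1 - X) ^ 12`. -/
def slotTable : List (SlotState × List ℤ) :=
  [ (.mk 1 0 0 0 0, [0, 1, -10, 48, -138, 273, -370, 379, -278, 137, -46, 10, -1]),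
    (.mk 0 0 0 0 0, [1, -12, 66, -220, 495, -792, 924, -792, 495, -220, 66, -12, 1]),
    (.mk 1 1 0 0 0, [0, 1, -10, 47, -135, 260, -350, 336, -232, 115, -40, 9, -1]),
    (.mk 1 0 1 0 0, [0, 1, -10, 47, -135, 261, -356, 351, -252, 130, -46, 10, -1]),
    (.mk 2 2 1 0 0, [0, 0, 2, -12, 48, -99, 161, -173, 126, -71, 30, -8, 1]),
    (.mk 1 1 1 0 0, [0, 1, -10, 46, -129, 246, -336, 336, -246, 129, -46, 10, -1]),
    (.mk 2 3 1 0 2, [0, 0, 1, -8, 29, -64, 98, -112, 98, -64, 29, -8, 1]),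
    (.mk 1 0 1 1 0, [0, 1, -11, 55, -165, 330, -462, 462, -330, 165, -55, 11, -1]),
    (.mk 2 2 3 1 0, [0, 0, 2, -16, 60, -140, 225, -258, 211, -120, 45, -10, 1]),
    (.mk 2 3 1 0 0, [0, 0, 2, -14, 50, -119, 197, -223, 169, -85, 29, -7, 1]),
    (.mk 2 2 1 1 0, [0, 0, 2, -15, 58, -136, 206, -215, 164, -93, 37, -9, 1]),
    (.mk 3 6 3 1 0, [0, 0, 0, 6, -24, 74, -153, 179, -126, 65, -28, 8, -1]),
    (.mk 2 2 3 0 0, [0, 0, 2, -14, 50, -116, 183, -198, 149, -80, 31, -8, 1]),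
    (.mk 3 6 3 0 32, [0, 0, 0, 3, -11, 36, -61, 69, -69, 49, -21, 6, -1]),
    (.mk 1 1 1 1 0, [0, 1, -11, 55, -165, 330, -462, 462, -330, 165, -55, 11, -1]),
    (.mk 2 3 3 1 2, [0, 0, 1, -10, 45, -120, 210, -252, 210, -120, 45, -10, 1]),
    (.mk 2 3 3 0 2, [0, 0, 1, -10, 45, -120, 210, -252, 210, -120, 45, -10, 1]),
    (.mk 3 7 3 0 38, [0, 0, 0, 1, -9, 36, -84, 126, -126, 84, -36, 9, -1]),
    (.mk 2 3 3 1 0, [0, 0, 2, -17, 65, -148, 224, -238, 182, -100, 38, -9, 1]),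
    (.mk 2 2 3 3 0, [0, 0, 1, -10, 45, -120, 210, -252, 210, -120, 45, -10, 1]),
    (.mk 3 6 7 3 32, [0, 0, 0, 2, -16, 57, -119, 161, -147, 91, -37, 9, -1]),
    (.mk 2 3 1 1 2, [0, 0, 1, -9, 37, -92, 154, -182, 154, -92, 37, -9, 1]),
    (.mk 3 7 3 1 6, [0, 0, 0, 2, -15, 50, -98, 126, -112, 70, -30, 8, -1]),
    (.mk 2 3 3 0 0, [0, 0, 2, -16, 57, -120, 168, -168, 126, -72, 30, -8, 1]),
    (.mk 3 7 3 0 36, [0, 0, 0, 2, -13, 36, -56, 56, -42, 28, -16, 6, -1]),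
    (.mk 2 3 1 1 0, [0, 0, 2, -16, 62, -150, 243, -268, 201, -102, 35, -8, 1]),
    (.mk 3 6 3 1 32, [0, 0, 0, 3, -16, 42, -77, 107, -107, 72, -31, 8, -1]),
    (.mk 3 7 3 1 0, [0, 0, 0, 5, -26, 67, -121, 161, -145, 81, -27, 6, -1]),
    (.mk 3 6 3 3 32, [0, 0, 0, 2, -13, 42, -87, 122, -116, 74, -31, 8, -1]),
    (.mk 4 14 7 3 192, [0, 0, 0, 0, 6, -27, 58, -83, 85, -59, 26, -7, 1]),
    (.mk 3 6 7 1 0, [0, 0, 0, 5, -28, 70, -109, 126, -115, 78, -35, 9, -1]),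
    (.mk 4 14 7 1 2176, [0, 0, 0, 0, 7, -26, 40, -42, 45, -41, 23, -7, 1]),
    (.mk 3 7 3 0 32, [0, 0, 0, 3, -16, 35, -43, 41, -43, 41, -25, 8, -1]),
    (.mk 4 14 7 1 2048, [0, 0, 0, 0, 11, -26, 24, -37, 69, -65, 31, -8, 1]),
    (.mk 3 6 7 0 32, [0, 0, 0, 2, -14, 46, -94, 131, -127, 84, -36, 9, -1]),
    (.mk 4 14 7 0 2240, [0, 0, 0, 0, 3, -14, 39, -70, 79, -58, 28, -8, 1]),
    (.mk 2 3 3 3 0, [0, 0, 1, -10, 45, -120, 210, -252, 210, -120, 45, -10, 1]),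
    (.mk 3 7 7 3 36, [0, 0, 0, 1, -9, 36, -84, 126, -126, 84, -36, 9, -1]),
    (.mk 3 7 7 3 32, [0, 0, 0, 2, -17, 64, -140, 196, -182, 112, -44, 10, -1]),
    (.mk 3 7 3 1 38, [0, 0, 0, 1, -9, 36, -84, 126, -126, 84, -36, 9, -1]),
    (.mk 3 7 7 1 6, [0, 0, 0, 1, -9, 36, -84, 126, -126, 84, -36, 9, -1]),
    (.mk 4 15 7 1 2190, [0, 0, 0, 0, 1, -8, 28, -56, 70, -56, 28, -8, 1]),
    (.mk 3 7 7 0 36, [0, 0, 0, 1, -9, 36, -84, 126, -126, 84, -36, 9, -1]),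
    (.mk 4 15 7 0 2252, [0, 0, 0, 0, 1, -8, 28, -56, 70, -56, 28, -8, 1]),
    (.mk 3 7 3 1 36, [0, 0, 0, 2, -14, 43, -77, 91, -77, 49, -23, 7, -1]),
    (.mk 3 7 3 1 32, [0, 0, 0, 3, -18, 47, -73, 81, -73, 53, -27, 8, -1]),
    (.mk 3 6 7 1 32, [0, 0, 0, 2, -16, 57, -119, 161, -147, 91, -37, 9, -1]),
    (.mk 4 14 7 1 2240, [0, 0, 0, 0, 3, -19, 53, -86, 90, -63, 29, -8, 1]),
    (.mk 3 7 3 3 36, [0, 0, 0, 1, -8, 29, -63, 91, -91, 63, -29, 8, -1]),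
    (.mk 4 15 7 3 204, [0, 0, 0, 0, 2, -13, 37, -61, 65, -47, 23, -7, 1]),
    (.mk 3 7 7 1 0, [0, 0, 0, 4, -28, 85, -147, 161, -119, 63, -25, 7, -1]),
    (.mk 4 15 7 1 2184, [0, 0, 0, 0, 4, -23, 55, -71, 55, -29, 13, -5, 1]),
    (.mk 3 7 3 3 32, [0, 0, 0, 2, -14, 45, -89, 121, -117, 79, -35, 9, -1]),
    (.mk 4 14 7 3 2240, [0, 0, 0, 0, 3, -19, 53, -86, 90, -63, 29, -8, 1]),
    (.mk 4 15 7 3 192, [0, 0, 0, 0, 5, -29, 73, -106, 100, -65, 29, -8, 1]),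
    (.mk 4 14 15 3 192, [0, 0, 0, 0, 3, -20, 58, -96, 100, -68, 30, -8, 1]),
    (.mk 5 30 15 3 541568, [0, 0, 0, 0, 0, 4, -21, 47, -59, 46, -23, 7, -1]),
    (.mk 3 6 7 7 0, [0, 0, 0, 1, -9, 36, -84, 126, -126, 84, -36, 9, -1]),
    (.mk 4 14 15 7 2176, [0, 0, 0, 0, 2, -14, 43, -76, 85, -62, 29, -8, 1]),
    (.mk 4 15 7 1 2176, [0, 0, 0, 0, 6, -29, 56, -56, 35, -21, 14, -6, 1]),
    (.mk 4 14 15 1 2176, [0, 0, 0, 0, 2, -14, 43, -76, 85, -62, 29, -8, 1]),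
    (.mk 5 30 15 1 549632, [0, 0, 0, 0, 0, 3, -16, 37, -49, 41, -22, 7, -1]),
    (.mk 4 15 7 1 2062, [0, 0, 0, 0, 2, -15, 49, -91, 105, -77, 35, -9, 1]),
    (.mk 3 7 7 0 32, [0, 0, 0, 2, -17, 64, -140, 196, -182, 112, -44, 10, -1]),
    (.mk 4 15 7 0 2248, [0, 0, 0, 0, 2, -15, 49, -91, 105, -77, 35, -9, 1]),
    (.mk 4 15 7 1 2048, [0, 0, 0, 0, 8, -35, 58, -46, 25, -23, 20, -8, 1]),
    (.mk 5 30 15 3 525184, [0, 0, 0, 0, 0, 8, -37, 73, -82, 59, -28, 8, -1]),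
    (.mk 4 14 15 1 2048, [0, 0, 0, 0, 5, -32, 89, -141, 140, -90, 37, -9, 1]),
    (.mk 5 30 15 1 549376, [0, 0, 0, 0, 0, 7, -35, 74, -87, 63, -29, 8, -1]),
    (.mk 4 15 7 0 2240, [0, 0, 0, 0, 3, -21, 64, -111, 120, -83, 36, -9, 1]),
    (.mk 5 30 15 1 548864, [0, 0, 0, 0, 0, 11, -48, 89, -94, 64, -29, 8, -1]),
    (.mk 3 7 7 1 36, [0, 0, 0, 1, -9, 36, -84, 126, -126, 84, -36, 9, -1]),
    (.mk 4 15 7 1 2252, [0, 0, 0, 0, 1, -8, 28, -56, 70, -56, 28, -8, 1]),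
    (.mk 3 7 7 1 32, [0, 0, 0, 2, -17, 64, -140, 196, -182, 112, -44, 10, -1]),
    (.mk 4 15 7 1 2248, [0, 0, 0, 0, 2, -15, 49, -91, 105, -77, 35, -9, 1]),
    (.mk 4 15 7 1 2240, [0, 0, 0, 0, 3, -21, 64, -111, 120, -83, 36, -9, 1]),
    (.mk 4 15 7 3 2252, [0, 0, 0, 0, 1, -8, 28, -56, 70, -56, 28, -8, 1]),
    (.mk 4 15 15 3 204, [0, 0, 0, 0, 1, -8, 28, -56, 70, -56, 28, -8, 1]),
    (.mk 5 31 15 3 541596, [0, 0, 0, 0, 0, 1, -7, 21, -35, 35, -21, 7, -1]),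
    (.mk 3 7 7 7 0, [0, 0, 0, 1, -9, 36, -84, 126, -126, 84, -36, 9, -1]),
    (.mk 4 15 15 7 2184, [0, 0, 0, 0, 1, -8, 28, -56, 70, -56, 28, -8, 1]),
    (.mk 4 15 15 1 2184, [0, 0, 0, 0, 1, -8, 28, -56, 70, -56, 28, -8, 1]),
    (.mk 5 31 15 1 549656, [0, 0, 0, 0, 0, 1, -7, 21, -35, 35, -21, 7, -1]),
    (.mk 4 15 7 3 2248, [0, 0, 0, 0, 2, -15, 49, -91, 105, -77, 35, -9, 1]),
    (.mk 4 15 7 3 2240, [0, 0, 0, 0, 3, -21, 64, -111, 120, -83, 36, -9, 1]),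
    (.mk 4 15 15 3 192, [0, 0, 0, 0, 2, -15, 49, -91, 105, -77, 35, -9, 1]),
    (.mk 5 31 15 3 541584, [0, 0, 0, 0, 0, 2, -13, 36, -55, 50, -27, 8, -1]),
    (.mk 5 31 15 3 541568, [0, 0, 0, 0, 0, 3, -18, 46, -65, 55, -28, 8, -1]),
    (.mk 4 15 15 7 2176, [0, 0, 0, 0, 2, -15, 49, -91, 105, -77, 35, -9, 1]),
    (.mk 4 15 15 1 2176, [0, 0, 0, 0, 2, -15, 49, -91, 105, -77, 35, -9, 1]),
    (.mk 5 31 15 1 549648, [0, 0, 0, 0, 0, 2, -13, 36, -55, 50, -27, 8, -1]),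
    (.mk 5 31 15 1 549632, [0, 0, 0, 0, 0, 3, -18, 46, -65, 55, -28, 8, -1]),
    (.mk 5 31 15 3 525212, [0, 0, 0, 0, 0, 2, -13, 36, -55, 50, -27, 8, -1]),
    (.mk 4 15 15 1 2048, [0, 0, 0, 0, 3, -22, 70, -126, 140, -98, 42, -10, 1]),
    (.mk 5 31 15 1 549392, [0, 0, 0, 0, 0, 3, -19, 51, -75, 65, -33, 9, -1]),
    (.mk 5 31 15 3 525184, [0, 0, 0, 0, 0, 5, -29, 71, -95, 75, -35, 9, -1]),
    (.mk 5 31 15 1 549376, [0, 0, 0, 0, 0, 5, -29, 71, -95, 75, -35, 9, -1]),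
    (.mk 5 31 15 1 548864, [0, 0, 0, 0, 0, 6, -34, 81, -105, 80, -36, 9, -1])]

/-- The numerator recorded for a state, if any. -/
def tableValue (T : SlotState) : Option (List ℤ) :=
  if T.dead then some [] else slotTable.lookup T

/-- The linear equation expressing the numerator of `e.1` through those of its successors. -/
def tableEntryOk (e : SlotState × List ℤ) : Bool :=
  (e.1.size == 0 && e.2 == [1, -12, 66, -220, 495, -792, 924, -792, 495, -220, 66, -12, 1]) ||
  (e.1.size != 0 && e.1.succs.all (fun T => (tableValue T).isSome) &&
    e.2 ++ [0] == 0 :: (e.1.succs.map fun T => (tableValue T).getD []).foldr addCoeffs [])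

theorem slotTable_ok : slotTable.all tableEntryOk = true := by
  decide +kernel

/-- Sum of `F` over the lists of `s` positive integers with sum `n`. -/
def compSum : ℕ → ℕ → (List ℕ → ℕ) → ℕ
  | 0, n, F => if n = 0 then F [] else 0
  | s + 1, n, F => ∑ p ∈ Finset.HasAntidiagonal.antidiagonal n,
      if p.1 = 0 then 0 else compSum s p.2 fun l => F (p.1 :: l)

theorem compSum_congr {s n : ℕ} {F G : List ℕ → ℕ}
    (h : ∀ l : List ℕ, l.length = s → l.sum = n → (∀ x ∈ l, 0 < x) → F l = G l) :
    compSum s n F = compSum s n G := by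
  induction s generalizing n F G with
  | zero =>
    simp only [compSum]
    split_ifs with hn
    · exact h [] rfl hn.symm (by simp)
    · rfl
  | succ s ih =>
    simp only [compSum]
    refine Finset.sum_congr rfl fun p hp => ?_
    split_ifs with h0
    · rfl
    · refine ih fun l hl hs hpos => h _ (by simp [hl]) ?_ ?_
      · simpa [hs] using Finset.HasAntidiagonal.mem_antidiagonal.1 hp
      · simpa [Nat.pos_iff_ne_zero, h0] using fun x hx => (hpos x hx).ne'

theorem compSum_finset_sum {ι : Type*} (s n : ℕ) (t : Finset ι) (F : ι → List ℕ → ℕ) :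
    compSum s n (fun l => ∑ i ∈ t, F i l) = ∑ i ∈ t, compSum s n (F i) := by
  induction s generalizing n F with
  | zero => simp only [compSum]; split_ifs <;> simp
  | succ s ih =>
    simp only [compSum, ih]
    rw [Finset.sum_comm]
    refine Finset.sum_congr rfl fun p _ => ?_
    split_ifs <;> simp

theorem compSum_zero (s n : ℕ) : compSum s n (fun _ => 0) = 0 := by
  simpa using compSum_finset_sum s n (∅ : Finset ℕ) fun _ _ => 0

theorem compSum_succ_zero (s : ℕ) (F : List ℕ → ℕ) : compSum (s + 1) 0 F = 0 := by
  simp [compSum]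

/-- The list `[x]`, or the empty list if `x = 0`. -/
def slotPart (x : ℕ) : List ℕ :=
  if x = 0 then [] else [x]

/-- The slot sizes after removing from slot `k` an entry with `j` values of that slot below it. -/
def splitSlot : List ℕ → ℕ → ℕ → List ℕ
  | [], _, _ => []
  | a :: l, 0, j => slotPart j ++ slotPart (a - 1 - j) ++ l
  | a :: l, k + 1, j => a :: splitSlot l k j

theorem sum_antidiagonal_eq_add_pos (n : ℕ) (Y : ℕ × ℕ → ℕ) :
    ∑ p ∈ Finset.HasAntidiagonal.antidiagonal n, Y p =
      Y (0, n) + ∑ p ∈ Finset.HasAntidiagonal.antidiagonal n, if p.1 = 0 then 0 else Y p := by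
  cases n with
  | zero => simp
  | succ n => simp [Finset.Nat.sum_antidiagonal_succ]

theorem sum_antidiagonal_assoc (n : ℕ) (X : ℕ → ℕ → ℕ → ℕ) :
    ∑ p ∈ Finset.HasAntidiagonal.antidiagonal n,
        ∑ q ∈ Finset.HasAntidiagonal.antidiagonal p.1, X q.1 q.2 p.2 =
      ∑ p ∈ Finset.HasAntidiagonal.antidiagonal n,
        ∑ q ∈ Finset.HasAntidiagonal.antidiagonal p.2, X p.1 q.1 q.2 := by
  rw [Finset.sum_sigma', Finset.sum_sigma']
  refine Finset.sum_nbij' (fun x => ⟨(x.2.1, x.2.2 + x.1.2), (x.2.2, x.1.2)⟩)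
    (fun x => ⟨(x.1.1 + x.2.1, x.2.2), (x.1.1, x.2.1)⟩) ?_ ?_ ?_ ?_ ?_ <;>
  · rintro ⟨⟨a, b⟩, ⟨c, d⟩⟩
    simp only [Finset.mem_sigma, Finset.HasAntidiagonal.mem_antidiagonal]
    grind

theorem compSum_split (t k n : ℕ) (hk : k ≤ t) (φ : Bool → Bool → List ℕ → ℕ) :
    compSum (t + 1) (n + 1) (fun l => ∑ j ∈ Finset.range (l.getD k 0),
        φ (decide (0 < j)) (decide (0 < l.getD k 0 - 1 - j)) (splitSlot l k j)) =
      compSum t n (φ false false) + compSum (t + 1) n (φ false true) +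
        (compSum (t + 1) n (φ true false) + compSum (t + 2) n (φ true true)) := by
  induction k generalizing t n φ with
  | zero =>
    let X : ℕ → ℕ → ℕ → ℕ := fun j j' b => compSum t b fun l =>
      φ (decide (0 < j)) (decide (0 < j')) (slotPart j ++ slotPart j' ++ l)
    trans ∑ p ∈ Finset.HasAntidiagonal.antidiagonal n,
      ∑ q ∈ Finset.HasAntidiagonal.antidiagonal p.1, X q.1 q.2 p.2
    · rw [compSum, Finset.Nat.sum_antidiagonal_succ]
      simp only [if_true, zero_add, Nat.succ_ne_zero, if_false, X]
      refine Finset.sum_congr rfl fun p _ => ?_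
      rw [← compSum_finset_sum]
      refine compSum_congr fun l _ _ _ => ?_
      rw [Finset.Nat.sum_antidiagonal_eq_sum_range_succ fun j j' =>
        φ (decide (0 < j)) (decide (0 < j')) (slotPart j ++ slotPart j' ++ l)]
      simp [splitSlot]
    · have h (p : ℕ × ℕ) : ∑ q ∈ Finset.HasAntidiagonal.antidiagonal p.2, X p.1 q.1 q.2 =
          X p.1 0 p.2 + ∑ q ∈ Finset.HasAntidiagonal.antidiagonal p.2,
            if q.1 = 0 then 0 else X p.1 q.1 q.2 :=
        sum_antidiagonal_eq_add_pos p.2 fun q => X p.1 q.1 q.2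
      rw [sum_antidiagonal_assoc n X, sum_antidiagonal_eq_add_pos, h]
      simp only [h]
      congr 1
      · congr 1
        rw [compSum]
        refine Finset.sum_congr rfl fun q _ => ?_
        split_ifs with h1
        · rfl
        · simp [X, slotPart, h1, Nat.pos_iff_ne_zero]
      · rw [compSum, compSum, ← Finset.sum_add_distrib]
        refine Finset.sum_congr rfl fun p _ => ?_
        split_ifs with h1
        · rfl
        congr 1
        · simp [X, slotPart, h1, Nat.pos_iff_ne_zero]
        · rw [compSum]
          refine Finset.sum_congr rfl fun q _ => ?_
          split_ifs with h2
          · rfl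
          · simp [X, slotPart, h1, h2, Nat.pos_iff_ne_zero]
  | succ k ih =>
    obtain ⟨t, rfl⟩ : ∃ u, t = u + 1 := ⟨t - 1, by omega⟩
    rw [compSum, Finset.Nat.sum_antidiagonal_succ']
    simp only [List.getD_cons_succ, splitSlot, compSum_succ_zero, ite_self]
    simp only [compSum, ← Finset.sum_add_distrib, zero_add]
    refine Finset.sum_congr rfl fun p _ => ?_
    split_ifs with h0
    · rfl
    · exact ih t p.2 (by omega) fun x y l => φ x y (p.1 :: l)

theorem testBit_bitMask (n : ℕ) (f : ℕ → Bool) (i : ℕ) :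
    (bitMask n f).testBit i = (decide (i < n) && f i) := by
  induction n with
  | zero => simp [bitMask]
  | succ n ih =>
    rw [bitMask] at ih ⊢
    simp only [Nat.testBit_or, ih, Nat.testBit_shiftLeft]
    rcases lt_trichotomy i n with h | rfl | h
    · simp [h, Nat.not_le.2 h, Nat.lt_succ_of_lt h]
    · cases f i <;> simp
    · obtain ⟨m, hm⟩ : ∃ m, i - n = m + 1 := ⟨i - n - 1, by omega⟩
      cases f n <;>
        simp [Nat.not_lt.2 h.le, Nat.not_lt.2 (Nat.succ_le_of_lt h), hm, Nat.testBit_succ]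

namespace SlotState

/-- The number of ways to fill the slots of `S` with `l i` entries in slot `i`, for a total of `n`
entries. -/
def fillCount : ℕ → SlotState → List ℕ → ℕ
  | 0, _, _ => 1
  | n + 1, S, l => ∑ k ∈ Finset.range S.size, ∑ j ∈ Finset.range (l.getD k 0),
      if S.ok k (decide (0 < j)) then
        fillCount n (S.step k (decide (0 < j)) (decide (0 < l.getD k 0 - 1 - j))) (splitSlot l k j)
      else 0

/-- The number of ways to fill the slots of `S` with `n` entries. -/
def count (S : SlotState) (n : ℕ) : ℕ :=
  compSum S.size n (fillCount n S)

theorem count_zero_of_size_ne (S : SlotState) (h : S.size ≠ 0) : S.count 0 = 0 := by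
  obtain ⟨s, hs⟩ := Nat.exists_eq_succ_of_ne_zero h
  rw [count, hs, compSum_succ_zero]

theorem count_of_size_eq (S : SlotState) (h : S.size = 0) (n : ℕ) :
    S.count n = if n = 0 then 1 else 0 := by
  rw [count, h, compSum]
  split_ifs with hn
  · rw [hn, fillCount]
  · rfl

theorem count_succ (S : SlotState) (n : ℕ) :
    S.count (n + 1) = (S.succs.map fun T => T.count n).sum := by
  have key : ∀ k ∈ Finset.range S.size,
      compSum S.size (n + 1) (fun l => ∑ j ∈ Finset.range (l.getD k 0),
        if S.ok k (decide (0 < j)) then fillCount n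
          (S.step k (decide (0 < j)) (decide (0 < l.getD k 0 - 1 - j))) (splitSlot l k j)
        else 0) =
      (([(false, false), (false, true), (true, false), (true, true)].flatMap fun p =>
        if S.ok k p.1 then [S.step k p.1 p.2] else []).map fun T => T.count n).sum := by
    intro k hk
    obtain ⟨t, ht⟩ : ∃ t, S.size = t + 1 :=
      ⟨S.size - 1, by have := Finset.mem_range.1 hk; omega⟩
    rw [Finset.mem_range, ht] at hk
    rw [ht, compSum_split t k n (by omega) fun lo hi l =>
      if S.ok k lo then fillCount n (S.step k lo hi) l else 0]
    cases h0 : S.ok k false <;> cases h1 : S.ok k true <;>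
      simp [h0, h1, count, compSum_zero, step, ht, add_assoc]
  simp only [count.eq_1 S, fillCount]
  rw [compSum_finset_sum, Finset.sum_congr rfl key, succs, List.map_flatMap, List.flatMap_def,
    List.sum_flatten, List.map_map, ← List.sum_toFinset _ List.nodup_range, List.toFinset_range]
  rfl

theorem above_step {S : SlotState} {k i : ℕ} {lo hi : Bool} (h : i < (S.step k lo hi).size) :
    (S.step k lo hi).above.testBit i =
      (S.above.testBit (origin k lo hi i) || !decide (i < k + lo.toNat)) := by
  simp only [step] at h ⊢
  simp [testBit_bitMask, h]

theorem below_step {S : SlotState} {k i : ℕ} {lo hi : Bool} (h : i < (S.step k lo hi).size) :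
    (S.step k lo hi).below.testBit i =
      (S.below.testBit (origin k lo hi i) || decide (i < k + lo.toNat)) := by
  simp only [step] at h ⊢
  simp [testBit_bitMask, h]

theorem desc_step {S : SlotState} {k i : ℕ} {lo hi : Bool} (h : i < (S.step k lo hi).size) :
    (S.step k lo hi).desc.testBit i =
      (S.desc.testBit (origin k lo hi i) || (S.below.testBit k && decide (i < k + lo.toNat))) := by
  simp only [step] at h ⊢
  simp [testBit_bitMask, h]

theorem ascBit_step {S : SlotState} {k i j : ℕ} {lo hi : Bool}
    (h : i < (S.step k lo hi).size) (h' : j < (S.step k lo hi).size) :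
    (S.step k lo hi).ascBit i j = (S.ascBit (origin k lo hi i) (origin k lo hi j) ||
      (S.above.testBit (origin k lo hi i) && decide (i < k + lo.toNat) &&
        !decide (j < k + lo.toNat))) := by
  rw [ascBit]
  simp only [step] at h h' ⊢
  have h1 : i * (S.size - 1 + lo.toNat + hi.toNat) + j <
      (S.size - 1 + lo.toNat + hi.toNat) * (S.size - 1 + lo.toNat + hi.toNat) := by nlinarith
  have h2 : (i * (S.size - 1 + lo.toNat + hi.toNat) + j) / (S.size - 1 + lo.toNat + hi.toNat)
      = i := by
    rw [mul_comm, Nat.mul_add_div (by omega), Nat.div_eq_of_lt h', add_zero]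
  have h3 : (i * (S.size - 1 + lo.toNat + hi.toNat) + j) % (S.size - 1 + lo.toNat + hi.toNat)
      = j := by
    rw [mul_comm, Nat.mul_add_mod, Nat.mod_eq_of_lt h']
  simp only [testBit_bitMask, h1, h2, h3, decide_true, Bool.true_and]

theorem ok_iff (S : SlotState) (k : ℕ) (lo : Bool) : S.ok k lo = true ↔
    (∀ j < S.size, S.ascBit k j = false) ∧
      (S.desc.testBit k = true → k = 0 ∧ lo = false) := by
  cases h : S.desc.testBit k <;> simp [ok, h]

theorem dead_iff (S : SlotState) : S.dead = true ↔ ∃ g h, g < h ∧ h < S.size ∧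
    S.ascBit g h = true ∧ (S.desc.testBit h = true ∨ ∃ i, h < i ∧ i < S.size ∧
      S.ascBit h i = true ∧ (S.below.testBit i = true ∨ ∃ j, i < j ∧ j < S.size ∧
        S.ascBit i j = true)) := by
  simp only [dead, List.any_eq_true, List.mem_range, Bool.and_eq_true, Bool.or_eq_true,
    decide_eq_true_eq]
  grind

theorem dead_step {S : SlotState} (hS : S.dead = true) {k : ℕ} {lo hi : Bool} (hk : k < S.size)
    (hok : S.ok k lo = true) : (S.step k lo hi).dead = true := by
  rw [ok_iff] at hok
  obtain ⟨hasc, hdesc⟩ := hok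
  obtain ⟨new, hnew⟩ : ∃ new : ℕ → ℕ, ∀ i, new i =
    if i < k then i else i - 1 + lo.toNat + hi.toNat := ⟨_, fun _ => rfl⟩
  have hsize : (S.step k lo hi).size = S.size - 1 + lo.toNat + hi.toNat := rfl
  have hlo : lo.toNat ≤ 1 := Bool.toNat_le lo
  have hhi : hi.toNat ≤ 1 := Bool.toNat_le hi
  have hlt : ∀ i < S.size, i ≠ k → new i < (S.step k lo hi).size := by grind
  have hor : ∀ i, i ≠ k → origin k lo hi (new i) = i := by
    intro i hi; rw [origin, hnew]; grind
  have hb : ∀ i, i < k → new i < k + lo.toNat := by grind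
  have hmono : ∀ i j, i < j → i ≠ k → j ≠ k → new i < new j := by grind
  have hA : ∀ i j, i < S.size → j < S.size → j ≠ k → S.ascBit i j = true →
      i ≠ k ∧ (S.step k lo hi).ascBit (new i) (new j) = true := by
    intro i j hi hj hjk h
    have hik : i ≠ k := by rintro rfl; simp [hasc j hj] at h
    exact ⟨hik, by rw [ascBit_step (hlt i hi hik) (hlt j hj hjk), hor i hik, hor j hjk, h]; simp⟩
  rw [dead_iff] at hS ⊢
  obtain ⟨g, h, hgh, hh, hAgh, H⟩ := hS
  have hhk : h ≠ k := by
    rintro rfl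
    rcases H with H | ⟨i, -, hi, H, -⟩
    · have := hdesc H; omega
    · simp [hasc i hi] at H
  obtain ⟨hgk, hA1⟩ := hA g h (by omega) hh hhk hAgh
  refine ⟨new g, new h, hmono g h hgh hgk hhk, hlt h hh hhk, hA1, ?_⟩
  rw [desc_step (hlt h hh hhk), hor h hhk]
  rcases H with H | ⟨i, hhi', hi', hAhi, H⟩
  · simp [H]
  by_cases hik : i = k
  · subst hik
    rcases H with H | ⟨j, -, hj, H⟩
    · simp [H, hb h hhi']
    · simp [hasc j hj] at H
  right
  refine ⟨new i, hmono h i hhi' hhk hik, hlt i hi' hik, (hA h i hh hi' hik hAhi).2, ?_⟩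
  rw [below_step (hlt i hi' hik), hor i hik]
  rcases H with H | ⟨j, hij, hj, H⟩
  · simp [H]
  by_cases hjk : j = k
  · subst hjk
    simp [hb i hij]
  · exact Or.inr ⟨new j, hmono i j hij hik hjk, hlt j hj hjk, (hA i j hi' hj hjk H).2⟩

theorem count_of_dead {S : SlotState} (hS : S.dead = true) (n : ℕ) : S.count n = 0 := by
  induction n generalizing S with
  | zero =>
    refine count_zero_of_size_ne S ?_
    obtain ⟨g, h, -, hh, -⟩ := (dead_iff S).1 hS
    omega
  | succ n ih =>
    rw [count_succ]
    refine List.sum_eq_zero fun c hc => ?_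
    obtain ⟨T, hT, rfl⟩ := List.mem_map.1 hc
    simp only [succs, List.mem_flatMap, List.mem_range] at hT
    obtain ⟨k, hk, p, -, hT⟩ := hT
    split_ifs at hT with hok
    · rw [List.mem_singleton.1 hT]
      exact ih (dead_step hS hk hok)
    · simp at hT

end SlotState

theorem getD_addCoeffs (l m : List ℤ) (n : ℕ) :
    (addCoeffs l m).getD n 0 = l.getD n 0 + m.getD n 0 := by
  induction l, m using addCoeffs.induct generalizing n with
  | case1 m => simp [addCoeffs]
  | case2 l => cases l <;> simp [addCoeffs]
  | case3 a l b m ih => cases n <;>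
    simp only [addCoeffs, List.getD_cons_zero, List.getD_cons_succ, ih]

theorem getD_foldr_addCoeffs (L : List (List ℤ)) (n : ℕ) :
    (L.foldr addCoeffs []).getD n 0 = (L.map fun l => l.getD n 0).sum := by
  induction L with
  | nil => simp
  | cons l L ih => simp only [List.foldr_cons, getD_addCoeffs, ih, List.map_cons, List.sum_cons]

open PowerSeries in
theorem mk_getD_cons (a : ℤ) (l : List ℤ) :
    mk (fun n => (a :: l).getD n 0) = C a + X * mk fun n => l.getD n 0 := by
  ext n
  cases n with
  | zero => simp
  | succ n => rw [map_add, coeff_succ_X_mul, coeff_C]; simp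

open PowerSeries in
theorem mk_getD_nil : mk (fun n => ([] : List ℤ).getD n 0) = 0 := by
  ext n
  simp

theorem mem_of_lookup_eq_some {α β : Type*} [BEq α] [LawfulBEq α] {l : List (α × β)} {k : α}
    {b : β} (h : l.lookup k = some b) : (k, b) ∈ l := by
  obtain ⟨l₁, l₂, rfl, -⟩ := List.lookup_eq_some_iff.1 h
  simp

namespace SlotState

open PowerSeries

/-- The generating function of `S.count`, times `(1 - X) ^ 12`. -/
noncomputable def numerator (S : SlotState) : PowerSeries ℤ :=
  (1 - X) ^ 12 * PowerSeries.mk fun n => (S.count n : ℤ)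

theorem numerator_of_dead {S : SlotState} (h : S.dead = true) : S.numerator = 0 := by
  have : (PowerSeries.mk fun n => (S.count n : ℤ)) = 0 := by ext n; simp [count_of_dead h]
  rw [numerator, this, mul_zero]

theorem numerator_of_size_eq {S : SlotState} (h : S.size = 0) : S.numerator = (1 - X) ^ 12 := by
  have : (PowerSeries.mk fun n => (S.count n : ℤ)) = 1 := by
    ext n; simp [count_of_size_eq S h, coeff_one]
  rw [numerator, this, mul_one]

theorem numerator_of_size_ne {S : SlotState} (h : S.size ≠ 0) :
    S.numerator = X * (S.succs.map numerator).sum := by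
  have key (L : List SlotState) : (L.map numerator).sum =
      (1 - X) ^ 12 * PowerSeries.mk fun n => ((L.map fun T => T.count n).sum : ℤ) := by
    induction L with
    | nil => ext n; simp [show (PowerSeries.mk fun _ => (0 : ℤ)) = 0 from rfl]
    | cons T L ih =>
      simp only [List.map_cons, List.sum_cons, ih, numerator, ← mul_add]
      congr 1
  rw [key, numerator, mul_left_comm]
  congr 1
  ext n
  cases n with
  | zero => simp [count_zero_of_size_ne S h]
  | succ n => simp [coeff_succ_X_mul, count_succ, Function.comp_def]

theorem one_sub_X_pow_twelve : ((1 - X) ^ 12 : PowerSeries ℤ) = PowerSeries.mk fun n =>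
    [1, -12, 66, -220, 495, -792, 924, -792, 495, -220, 66, -12, 1].getD n 0 := by
  simp only [mk_getD_cons, mk_getD_nil]
  simp only [map_neg, map_one, map_ofNat]
  ring

theorem coeff_numerator (n : ℕ) (e : SlotState × List ℤ) (he : e ∈ slotTable) :
    coeff n e.1.numerator = e.2.getD n 0 := by
  induction n using Nat.strong_induction_on generalizing e with
  | h n ih =>
  have hok := List.all_eq_true.1 slotTable_ok e he
  simp only [tableEntryOk, Bool.or_eq_true, Bool.and_eq_true, beq_iff_eq, bne_iff_ne,
    List.all_eq_true] at hok
  rcases hok with ⟨hs, hl⟩ | ⟨⟨hs, hsome⟩, hl⟩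
  · rw [numerator_of_size_eq hs, one_sub_X_pow_twelve, coeff_mk, hl]
  · have h1 : e.2.getD n 0 = (e.2 ++ [0]).getD n 0 := by
      rcases lt_trichotomy n e.2.length with h | h | h
      · rw [List.getD_append _ _ _ _ h]
      · rw [List.getD_append_right _ _ _ _ h.ge]; simp [h]
      · rw [List.getD_append_right _ _ _ _ h.le, List.getD_eq_default _ _ h.le,
          List.getD_eq_default _ _ (by simp; omega)]
    rw [h1, hl, numerator_of_size_ne hs]
    cases n with
    | zero => simp
    | succ n =>
      rw [coeff_succ_X_mul, List.getD_cons_succ, getD_foldr_addCoeffs, map_list_sum,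
        List.map_map, List.map_map]
      congr 1
      refine List.map_congr_left fun T hT => ?_
      have hT := hsome T hT
      simp only [Function.comp_apply]
      rw [tableValue] at hT ⊢
      split_ifs at hT ⊢ with hd
      · rw [numerator_of_dead hd]; simp
      · obtain ⟨N, hN⟩ := Option.isSome_iff_exists.1 hT
        rw [hN]
        exact ih n (Nat.lt_succ_self n) (T, N) (mem_of_lookup_eq_some hN)

theorem numerator_initial : (SlotState.mk 1 0 0 0 0).numerator = PowerSeries.mk fun n =>
    [0, 1, -10, 48, -138, 273, -370, 379, -278, 137, -46, 10, -1].getD n 0 := by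
  ext n
  rw [coeff_mk]
  exact coeff_numerator n (_, _) (List.mem_cons_self ..)

theorem mul_mk_count_initial (a : ℕ → ℕ) (h0 : a 0 = 1)
    (h : ∀ n, a (n + 1) = (SlotState.mk 1 0 0 0 0).count (n + 1)) :
    (1 - X : PowerSeries ℤ) ^ 12 * PowerSeries.mk (fun n => (a n : ℤ)) =
      1 - 11 * X + 56 * X ^ 2 - 172 * X ^ 3 + 357 * X ^ 4 - 519 * X ^ 5 + 554 * X ^ 6
        - 413 * X ^ 7 + 217 * X ^ 8 - 83 * X ^ 9 + 20 * X ^ 10 - 2 * X ^ 11 := by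
  have : PowerSeries.mk (fun n => (a n : ℤ)) =
      1 + PowerSeries.mk fun n => ((SlotState.mk 1 0 0 0 0).count n : ℤ) := by
    ext n
    cases n with
    | zero => simp [h0, count_zero_of_size_ne]
    | succ n => simp [h, coeff_one]
  rw [this, mul_add, mul_one, ← numerator, numerator_initial]
  simp only [mk_getD_cons, mk_getD_nil]
  simp only [map_neg, map_one, map_ofNat, map_zero]
  ring

end SlotState

/-- What a prefix of a word imposes on the entries still to come: which values lie above (below)
some entry of the prefix, which lie below the lower entry of a descent of the prefix, and for which
pairs `x`, `y` the prefix contains an ascent `u … v` with `u < x < v < y`. -/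
structure ValueState where
  above : ℕ → Prop
  below : ℕ → Prop
  desc : ℕ → Prop
  asc : ℕ → ℕ → Prop

namespace ValueState

/-- The state of the empty prefix. -/
def initial : ValueState :=
  ⟨fun _ => False, fun _ => False, fun _ => False, fun _ _ => False⟩

/-- Reading `v` before the values of `w` does not force an occurrence of 1324 or 4321. -/
def Ok (st : ValueState) (v : ℕ) (w : List ℕ) : Prop :=
  (∀ y ∈ w, ¬ st.asc v y) ∧ (st.desc v → ∀ y ∈ w, ¬ y < v)

/-- The state after reading `v`. -/
def step (st : ValueState) (v : ℕ) : ValueState where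
  above x := st.above x ∨ v < x
  below x := st.below x ∨ x < v
  desc x := st.desc x ∨ (st.below v ∧ x < v)
  asc x y := st.asc x y ∨ (st.above x ∧ x < v ∧ v < y)

/-- The word can be read from the given state without creating an occurrence of 1324 or 4321. -/
def Good : ValueState → List ℕ → Prop
  | _, [] => True
  | st, v :: w => st.Ok v w ∧ Good (st.step v) w

end ValueState

theorem cons_sublist_cons_iff {x v : ℕ} {l w : List ℕ} :
    (x :: l).Sublist (v :: w) ↔ (x :: l).Sublist w ∨ x = v ∧ l.Sublist w := by
  rw [List.sublist_cons_iff]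
  simp

namespace ValueState

theorem good_iff (st : ValueState) (w : List ℕ) : st.Good w ↔
    (∀ x y, [x, y].Sublist w → ¬ st.asc x y) ∧
    (∀ x y, [x, y].Sublist w → st.desc x → ¬ y < x) ∧
    (∀ v x y, [v, x, y].Sublist w → st.above x → ¬ (x < v ∧ v < y)) ∧
    (∀ v x y, [v, x, y].Sublist w → st.below v → ¬ (y < x ∧ x < v)) ∧
    (∀ u v x y, [u, v, x, y].Sublist w → ¬ (u < x ∧ x < v ∧ v < y)) ∧
    (∀ u v x y, [u, v, x, y].Sublist w → ¬ (y < x ∧ x < v ∧ v < u)) := by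
  induction w generalizing st with
  | nil => simp [Good]
  | cons a w ih =>
    rw [Good, ih]
    simp only [cons_sublist_cons_iff, Ok, step, List.singleton_sublist]
    constructor
    · rintro ⟨⟨h1, h2⟩, h3, h4, h5, h6, h7, h8⟩
      refine ⟨?_, ?_, ?_, ?_, ?_, ?_⟩
      · rintro x y (h | ⟨rfl, h⟩) <;> grind
      · rintro x y (h | ⟨rfl, h⟩) <;> grind
      · rintro v x y (h | ⟨rfl, h⟩) <;> grind
      · rintro v x y (h | ⟨rfl, h⟩) <;> grind
      · rintro u v x y (h | ⟨rfl, h⟩) <;> grind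
      · rintro u v x y (h | ⟨rfl, h⟩) <;> grind
    · rintro ⟨h1, h2, h3, h4, h5, h6⟩
      refine ⟨⟨fun y hy => h1 a y (.inr ⟨rfl, hy⟩), fun hd y hy => h2 a y (.inr ⟨rfl, hy⟩) hd⟩,
        ?_, ?_, ?_, ?_, ?_, ?_⟩
      · intro x y h
        have := h1 x y (.inl h)
        have := h3 a x y (.inr ⟨rfl, h⟩)
        tauto
      · intro x y h
        have := h2 x y (.inl h)
        have := h4 a x y (.inr ⟨rfl, h⟩)
        tauto
      · intro v x y h
        have := h3 v x y (.inl h)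
        have := h5 a v x y (.inr ⟨rfl, h⟩)
        tauto
      · intro v x y h
        have := h4 v x y (.inl h)
        have := h6 a v x y (.inr ⟨rfl, h⟩)
        tauto
      · exact fun u v x y h => h5 u v x y (.inl h)
      · exact fun u v x y h => h6 u v x y (.inl h)

end ValueState

theorem pContains_iff (π β : List ℕ) : PContains π β ↔ ∃ l : List ℕ, l.Sublist π ∧
    ∃ h : l.length = β.length, ∀ s t : Fin l.length,
      l.get s < l.get t ↔ β.get (s.cast h) < β.get (t.cast h) := by
  constructor
  · rintro ⟨f, hf, h⟩
    refine ⟨List.ofFn fun i => π.get (f i), ?_, by simp, fun s t => ?_⟩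
    · rw [List.sublist_iff_exists_fin_orderEmbedding_get_eq]
      refine ⟨(Fin.castOrderIso (by simp)).toOrderEmbedding.trans
        (OrderEmbedding.ofStrictMono f hf), fun i => ?_⟩
      simp
      rfl
    · simp only [List.get_ofFn]
      exact h (s.cast (by simp)) (t.cast (by simp))
  · rintro ⟨l, hl, h, hlt⟩
    obtain ⟨f, hf⟩ := List.sublist_iff_exists_fin_orderEmbedding_get_eq.1 hl
    refine ⟨fun i => f (i.cast h.symm), fun i j hij => f.strictMono (by simpa using hij),
      fun s t => ?_⟩
    rw [← hf, ← hf, hlt]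
    rfl

theorem pContains_four (π : List ℕ) (a b c d : ℕ) : PContains π [a, b, c, d] ↔
    ∃ u v x y, [u, v, x, y].Sublist π ∧ ∀ s t : Fin 4,
      [u, v, x, y].get s < [u, v, x, y].get t ↔ [a, b, c, d].get s < [a, b, c, d].get t := by
  rw [pContains_iff]
  constructor
  · rintro ⟨l, hl, h, H⟩
    obtain ⟨u, v, x, y, rfl⟩ := List.length_eq_four.1 h
    exact ⟨u, v, x, y, hl, H⟩
  · rintro ⟨u, v, x, y, hl, H⟩
    exact ⟨_, hl, rfl, H⟩

theorem good_initial_iff (w : List ℕ) :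
    ValueState.initial.Good w ↔ PAvoids w [4, 3, 2, 1] ∧ PAvoids w [1, 3, 2, 4] := by
  have h1 (u v x y : ℕ) : (∀ s t : Fin 4, [u, v, x, y].get s < [u, v, x, y].get t ↔
      [4, 3, 2, 1].get s < [4, 3, 2, 1].get t) ↔ y < x ∧ x < v ∧ v < u := by
    simp [Fin.forall_fin_succ]
    omega
  have h2 (u v x y : ℕ) : (∀ s t : Fin 4, [u, v, x, y].get s < [u, v, x, y].get t ↔
      [1, 3, 2, 4].get s < [1, 3, 2, 4].get t) ↔ u < x ∧ x < v ∧ v < y := by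
    simp [Fin.forall_fin_succ]
    omega
  rw [ValueState.good_iff, PAvoids, PAvoids, pContains_four, pContains_four]
  simp only [h1, h2]
  simp only [ValueState.initial, not_exists, not_and, not_false_eq_true, implies_true, true_and,
    false_imp_iff]
  exact and_comm

namespace ValueState

open Classical in
/-- The number of arrangements of `R` that can be read from the given state. -/
noncomputable def goodCount (st : ValueState) (R : List ℕ) : ℕ :=
  (R.permutations.toFinset.filter fun w => st.Good w).card

theorem goodCount_eq_ncard (st : ValueState) (R : List ℕ) :
    st.goodCount R = Set.ncard {w | w.Perm R ∧ st.Good w} := by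
  classical
  rw [goodCount, ← Set.ncard_coe_finset]
  congr 1
  ext w
  simp

theorem goodCount_nil (st : ValueState) : st.goodCount [] = 1 := by
  rw [goodCount_eq_ncard, Set.ncard_eq_one]
  exact ⟨[], by ext w; cases w <;> simp [Good]⟩

theorem goodCount_perm (st : ValueState) {R R' : List ℕ} (h : R.Perm R') :
    st.goodCount R = st.goodCount R' := by
  simp only [goodCount_eq_ncard, h.congr_right]

theorem ok_perm (st : ValueState) (v : ℕ) {R R' : List ℕ} (h : R.Perm R') :
    st.Ok v R ↔ st.Ok v R' := by
  simp only [Ok, h.mem_iff]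

open Classical in
theorem goodCount_eq_sum (st : ValueState) {R : List ℕ} (hR : R.Nodup) (h0 : R ≠ []) :
    st.goodCount R = (R.map fun v =>
      if st.Ok v (R.erase v) then (st.step v).goodCount (R.erase v) else 0).sum := by
  rw [← List.sum_toFinset _ hR, goodCount,
    Finset.card_eq_sum_card_fiberwise (f := fun w => w.headD 0) (t := R.toFinset)]
  · refine Finset.sum_congr rfl fun v hv => ?_
    have hv : v ∈ R := by simpa using hv
    split_ifs with hok
    · rw [goodCount, ← Finset.card_image_of_injective
        ((R.erase v).permutations.toFinset.filter fun w => (st.step v).Good w)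
        (List.cons_injective (a := v))]
      congr 1
      ext w
      simp only [Finset.mem_filter, List.mem_toFinset, List.mem_permutations, Finset.mem_image]
      constructor
      · rintro ⟨⟨hw, hg⟩, hh⟩
        cases w with
        | nil => exact absurd hw.nil_eq.symm h0
        | cons x w =>
          obtain rfl : x = v := hh
          exact ⟨w, ⟨(List.cons_perm_iff_perm_erase.1 hw).2, hg.2⟩, rfl⟩
      · rintro ⟨w, ⟨hw, hg⟩, rfl⟩
        exact ⟨⟨List.cons_perm_iff_perm_erase.2 ⟨hv, hw⟩, (st.ok_perm v hw).2 hok, hg⟩, rfl⟩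
    · rw [Finset.card_eq_zero, Finset.filter_eq_empty_iff]
      intro w hw hh
      simp only [Finset.mem_filter, List.mem_toFinset, List.mem_permutations] at hw
      cases w with
      | nil => exact absurd hw.1.nil_eq.symm h0
      | cons x w =>
        obtain rfl : x = v := hh
        exact hok ((st.ok_perm x (List.cons_perm_iff_perm_erase.1 hw.1).2).1 hw.2.1)
  · intro w hw
    simp only [Finset.coe_filter, List.mem_toFinset, List.mem_permutations,
      Set.mem_ofPred_eq] at hw
    cases w with
    | nil => exact absurd hw.1.nil_eq.symm h0
    | cons x w => simpa using hw.1.mem_iff.1 (List.mem_cons_self ..)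

end ValueState

/-- The list `[l]`, or the empty list if `l` is empty. -/
def blockPart (l : List ℕ) : List (List ℕ) :=
  if l = [] then [] else [l]

/-- The blocks after removing the `j`-th entry of block `k` and splitting the block there. -/
def splitBlock : List (List ℕ) → ℕ → ℕ → List (List ℕ)
  | [], _, _ => []
  | b :: B, 0, j => blockPart (b.take j) ++ blockPart (b.drop (j + 1)) ++ B
  | b :: B, k + 1, j => b :: splitBlock B k j

theorem map_length_blockPart (l : List ℕ) :
    (blockPart l).map List.length = slotPart l.length := by
  cases l <;> simp [blockPart, slotPart]

theorem flatten_blockPart (l : List ℕ) : (blockPart l).flatten = l := by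
  cases l <;> simp [blockPart]

theorem map_length_splitBlock {B : List (List ℕ)} {k j : ℕ} (hj : j < (B.getD k []).length) :
    (splitBlock B k j).map List.length = splitSlot (B.map List.length) k j := by
  induction B generalizing k with
  | nil => simp at hj
  | cons b B ih =>
    cases k with
    | zero =>
      rw [List.getD_cons_zero] at hj
      simp [splitBlock, splitSlot, map_length_blockPart, hj.le, Nat.sub_sub, Nat.add_comm]
    | succ k => rw [splitBlock, List.map_cons, ih (by simpa using hj)]; rfl

theorem length_slotPart (x : ℕ) : (slotPart x).length = (decide (0 < x)).toNat := by
  cases x <;> simp [slotPart]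

theorem length_splitSlot {l : List ℕ} {k : ℕ} (hk : k < l.length) (j : ℕ) :
    (splitSlot l k j).length =
      l.length - 1 + (decide (0 < j)).toNat + (decide (0 < l.getD k 0 - 1 - j)).toNat := by
  induction l generalizing k with
  | nil => simp at hk
  | cons a l ih =>
    cases k with
    | zero => simp [splitSlot, length_slotPart]; omega
    | succ k =>
      have hk : k < l.length := by simpa using hk
      rw [splitSlot, List.length_cons, ih hk, List.getD_cons_succ, List.length_cons]
      omega

theorem ne_nil_of_mem_splitBlock {B : List (List ℕ)} (hB : ∀ b ∈ B, b ≠ []) (k j : ℕ) :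
    ∀ b ∈ splitBlock B k j, b ≠ [] := by
  induction B generalizing k with
  | nil => simp [splitBlock]
  | cons b B ih =>
    rw [List.forall_mem_cons] at hB
    cases k with
    | zero =>
      intro c hc
      simp only [splitBlock, blockPart, List.mem_append] at hc
      rcases hc with (hc | hc) | hc
      · split_ifs at hc with h <;> simp_all
      · split_ifs at hc with h <;> simp_all
      · exact hB.2 c hc
    | succ k => exact List.forall_mem_cons.2 ⟨hB.1, ih hB.2 k⟩

theorem flatten_perm_cons_splitBlock {B : List (List ℕ)} {k j : ℕ}
    (hj : j < (B.getD k []).length) :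
    B.flatten.Perm ((B.getD k []).getD j 0 :: (splitBlock B k j).flatten) := by
  induction B generalizing k with
  | nil => simp at hj
  | cons b B ih =>
    cases k with
    | zero =>
      rw [List.getD_cons_zero] at hj ⊢
      simp only [splitBlock, List.flatten_append, flatten_blockPart, List.flatten_cons]
      rw [← List.cons_append, List.getD_eq_getElem _ _ hj]
      refine List.Perm.append_right _ ?_
      conv_lhs => rw [← List.take_append_drop j b, List.drop_eq_getElem_cons hj]
      exact List.perm_middle
    | succ k =>
      rw [List.getD_cons_succ] at hj ⊢
      rw [splitBlock, List.flatten_cons, List.flatten_cons]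
      exact ((ih hj).append_left b).trans List.perm_middle

theorem flatten_splitBlock_sublist (B : List (List ℕ)) (k j : ℕ) :
    (splitBlock B k j).flatten.Sublist B.flatten := by
  induction B generalizing k with
  | nil => simp [splitBlock]
  | cons b B ih =>
    cases k with
    | zero =>
      simp only [splitBlock, List.flatten_append, flatten_blockPart, List.flatten_cons]
      refine List.Sublist.append_right ?_ _
      conv_rhs => rw [← List.take_append_drop j b]
      exact List.Sublist.append_left (List.drop_sublist_drop_left _ (Nat.le_succ j)) _
    | succ k => exact (ih k).append_left b

theorem exists_mem_getD_of_mem_flatten {B : List (List ℕ)} {x : ℕ} (h : x ∈ B.flatten) :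
    ∃ i < B.length, x ∈ B.getD i [] := by
  obtain ⟨b, hb, hx⟩ := List.mem_flatten.1 h
  obtain ⟨i, hi, rfl⟩ := List.getElem_of_mem hb
  exact ⟨i, hi, by rwa [List.getD_eq_getElem _ _ hi]⟩

theorem mem_flatten_of_mem_getD {B : List (List ℕ)} {x i : ℕ} (h : x ∈ B.getD i []) :
    i < B.length ∧ x ∈ B.flatten := by
  have hi : i < B.length := by
    by_contra hi
    rw [List.getD_eq_default _ _ (not_lt.1 hi)] at h
    simp at h
  rw [List.getD_eq_getElem _ _ hi] at h
  exact ⟨hi, List.mem_flatten.2 ⟨_, List.getElem_mem hi, h⟩⟩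

theorem getD_blockPart_append (l : List ℕ) (B : List (List ℕ)) (i : ℕ) :
    (blockPart l ++ B).getD i [] =
      if i < (decide (0 < l.length)).toNat then l
      else B.getD (i - (decide (0 < l.length)).toNat) [] := by
  cases l with
  | nil => simp [blockPart]
  | cons a l => cases i <;> simp [blockPart]

theorem mem_getD_splitBlock {B : List (List ℕ)} (hB : B.flatten.Pairwise (· < ·)) {k j i x : ℕ}
    (hj : j < (B.getD k []).length) (hx : x ∈ (splitBlock B k j).getD i []) :
    x ∈ B.getD (SlotState.origin k (decide (0 < j))
      (decide (0 < (B.getD k []).length - 1 - j)) i) [] ∧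
    (x < (B.getD k []).getD j 0 ↔ i < k + (decide (0 < j)).toNat) ∧
    x ≠ (B.getD k []).getD j 0 := by
  induction B generalizing k i with
  | nil => simp at hj
  | cons b B ih =>
    rw [List.flatten_cons, List.pairwise_append] at hB
    obtain ⟨hb, hB, hbB⟩ := hB
    cases k with
    | zero =>
      simp only [List.getD_cons_zero] at hj ⊢
      rw [List.getD_eq_getElem _ _ hj]
      have hbj : b[j] ∈ b := List.getElem_mem hj
      have hsplit := List.take_append_drop j b
      rw [List.drop_eq_getElem_cons hj] at hsplit
      have hb' := hb
      rw [← hsplit, List.pairwise_append, List.pairwise_cons] at hb'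
      obtain ⟨-, ⟨hgt, -⟩, hlt⟩ := hb'
      have hlen : (decide (0 < (b.take j).length)) = decide (0 < j) := by
        simp [hj.le]
      have hlen' : (decide (0 < (b.drop (j + 1)).length)) = decide (0 < b.length - 1 - j) := by
        congr 1; simp; omega
      rw [splitBlock, List.append_assoc, getD_blockPart_append, getD_blockPart_append, hlen,
        hlen'] at hx
      rw [SlotState.origin, zero_add]
      split_ifs at hx ⊢ with h1 h2
      · have h0 : i = 0 := by have := Bool.toNat_le (decide (0 < j)); omega
        have := hlt x hx b[j] (List.mem_cons_self ..)
        rw [h0]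
        exact ⟨List.mem_of_mem_take hx, by simp_all, by omega⟩
      · have := hgt x hx
        have h0 : i + 1 - ((decide (0 < j)).toNat + (decide (0 < b.length - 1 - j)).toNat) = 0 := by
          have := Bool.toNat_le (decide (0 < b.length - 1 - j)); omega
        rw [h0]
        exact ⟨List.mem_of_mem_drop hx, by simp [h1]; omega, by omega⟩
      · have := hbB _ hbj x (mem_flatten_of_mem_getD hx).2
        have h0 : i + 1 - ((decide (0 < j)).toNat + (decide (0 < b.length - 1 - j)).toNat) =
            i - (decide (0 < j)).toNat - (decide (0 < b.length - 1 - j)).toNat + 1 := by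
          omega
        rw [h0, List.getD_cons_succ]
        exact ⟨hx, by simp [h1]; omega, by omega⟩
    | succ k =>
      simp only [List.getD_cons_succ] at hj ⊢
      cases i with
      | zero =>
        rw [splitBlock, List.getD_cons_zero] at hx
        have hv : (B.getD k []).getD j 0 ∈ B.flatten := by
          rw [List.getD_eq_getElem _ _ hj]
          exact (mem_flatten_of_mem_getD (List.getElem_mem hj)).2
        have := hbB x hx _ hv
        refine ⟨?_, by simp only [this, true_iff]; omega, by omega⟩
        rw [SlotState.origin, if_pos (by omega)]
        exact hx
      | succ i =>
        rw [splitBlock, List.getD_cons_succ] at hx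
        obtain ⟨h1, h2, h3⟩ := ih hB hj hx
        refine ⟨?_, by rw [h2]; omega, h3⟩
        rw [SlotState.origin] at h1 ⊢
        have := Bool.toNat_le (decide (0 < (B.getD k []).length - 1 - j))
        split_ifs at h1 ⊢ with h4 h5
        · exact h1
        · omega
        · omega
        · rw [show i + 1 + 1 - ((decide (0 < j)).toNat +
            (decide (0 < (B.getD k []).length - 1 - j)).toNat) = i + 1 - ((decide (0 < j)).toNat +
            (decide (0 < (B.getD k []).length - 1 - j)).toNat) + 1 by omega, List.getD_cons_succ]
          exact h1

/-- The blocks `B` fill the slots of `S`, and on their entries `st` agrees with `S`. -/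
structure Represents (st : ValueState) (S : SlotState) (B : List (List ℕ)) : Prop where
  length_eq : B.length = S.size
  ne_nil : ∀ b ∈ B, b ≠ []
  sorted : B.flatten.Pairwise (· < ·)
  above_iff : ∀ i x, x ∈ B.getD i [] → (st.above x ↔ S.above.testBit i = true)
  below_iff : ∀ i x, x ∈ B.getD i [] → (st.below x ↔ S.below.testBit i = true)
  desc_iff : ∀ i x, x ∈ B.getD i [] → (st.desc x ↔ S.desc.testBit i = true)
  asc_iff : ∀ i j x y, x ∈ B.getD i [] → y ∈ B.getD j [] →
    (st.asc x y ↔ S.ascBit i j = true)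
  asc_irrefl : ∀ x, ¬ st.asc x x

namespace Represents

variable {st : ValueState} {S : SlotState} {B : List (List ℕ)} {k j : ℕ}

theorem length_splitBlock (h : Represents st S B) (hj : j < (B.getD k []).length) :
    (splitBlock B k j).length = (S.step k (decide (0 < j))
      (decide (0 < (B.getD k []).length - 1 - j))).size := by
  have hk : k < B.length := (mem_flatten_of_mem_getD (List.getElem_mem hj)).1
  rw [← List.length_map List.length, map_length_splitBlock hj, length_splitSlot (by simpa using hk)]
  simp only [SlotState.step, List.length_map, h.length_eq]
  simp [List.getD_eq_getElem?_getD, hk]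

theorem step (h : Represents st S B) (hj : j < (B.getD k []).length) :
    Represents (st.step ((B.getD k []).getD j 0)) (S.step k (decide (0 < j))
      (decide (0 < (B.getD k []).length - 1 - j))) (splitBlock B k j) := by
  have hsz := h.length_splitBlock hj
  have hv : (B.getD k []).getD j 0 ∈ B.getD k [] := by
    rw [List.getD_eq_getElem _ _ hj]
    exact List.getElem_mem hj
  have hmem {i x : ℕ} (hx : x ∈ (splitBlock B k j).getD i []) :=
    mem_getD_splitBlock h.sorted hj hx
  have hlt {i x : ℕ} (hx : x ∈ (splitBlock B k j).getD i []) := hsz ▸ (mem_flatten_of_mem_getD hx).1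
  refine ⟨hsz, ne_nil_of_mem_splitBlock h.ne_nil k j,
    h.sorted.sublist (flatten_splitBlock_sublist B k j), ?_, ?_, ?_, ?_, ?_⟩
  · intro i x hx
    obtain ⟨h1, h2, h3⟩ := hmem hx
    change (st.above x ∨ _) ↔ _
    rw [SlotState.above_step (hlt hx), h.above_iff _ _ h1, Bool.or_eq_true,
      Bool.not_eq_true', decide_eq_false_iff_not, ← h2]
    exact or_congr_right (by omega)
  · intro i x hx
    obtain ⟨h1, h2, h3⟩ := hmem hx
    change (st.below x ∨ _) ↔ _
    rw [SlotState.below_step (hlt hx), h.below_iff _ _ h1, Bool.or_eq_true,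
      decide_eq_true_iff, ← h2]
  · intro i x hx
    obtain ⟨h1, h2, h3⟩ := hmem hx
    change (st.desc x ∨ _) ↔ _
    rw [SlotState.desc_step (hlt hx), h.desc_iff _ _ h1, h.below_iff _ _ hv,
      Bool.or_eq_true, Bool.and_eq_true, decide_eq_true_iff, ← h2]
  · intro i i' x y hx hy
    obtain ⟨h1, h2, h3⟩ := hmem hx
    obtain ⟨h1', h2', h3'⟩ := hmem hy
    change (st.asc x y ∨ st.above x ∧ _) ↔ _
    rw [SlotState.ascBit_step (hlt hx) (hlt hy), h.asc_iff _ _ _ _ h1 h1',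
      h.above_iff _ _ h1, Bool.or_eq_true, Bool.and_eq_true, Bool.and_eq_true, decide_eq_true_iff,
      Bool.not_eq_true', decide_eq_false_iff_not, ← h2, ← h2', and_assoc]
    exact or_congr_right (and_congr_right fun _ => and_congr_right fun _ => by omega)
  · rintro x (hx | ⟨-, h1, h2⟩)
    · exact h.asc_irrefl x hx
    · omega

theorem ok_iff (h : Represents st S B) (hj : j < (B.getD k []).length) :
    st.Ok ((B.getD k []).getD j 0) (splitBlock B k j).flatten ↔
      S.ok k (decide (0 < j)) = true := by
  have hsz := h.length_splitBlock hj
  have hk : k < B.length := (mem_flatten_of_mem_getD (List.getElem_mem hj)).1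
  have hv : (B.getD k []).getD j 0 ∈ B.getD k [] := by
    rw [List.getD_eq_getElem _ _ hj]
    exact List.getElem_mem hj
  have hperm := flatten_perm_cons_splitBlock hj
  have hmem {i x : ℕ} (hx : x ∈ (splitBlock B k j).getD i []) :=
    mem_getD_splitBlock h.sorted hj hx
  rw [SlotState.ok_iff, ValueState.Ok, h.desc_iff _ _ hv]
  refine and_congr ⟨fun H i hi => ?_, fun H y hy => ?_⟩ (imp_congr_right fun _ => ?_)
  · rw [← h.length_eq] at hi
    have hne := h.ne_nil _ (List.getElem_mem hi)
    obtain ⟨y, hy⟩ := List.exists_mem_of_ne_nil _ hne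
    rw [← List.getD_eq_getElem _ [] hi] at hy
    rw [← Bool.not_eq_true, ← h.asc_iff _ _ _ _ hv hy]
    rcases List.mem_cons.1 (hperm.mem_iff.1 (mem_flatten_of_mem_getD hy).2) with rfl | hy'
    · exact h.asc_irrefl _
    · exact H y hy'
  · obtain ⟨i, hi, hi'⟩ := exists_mem_getD_of_mem_flatten
      (hperm.mem_iff.2 (List.mem_cons_of_mem _ hy))
    rw [h.asc_iff _ _ _ _ hv hi', H i (h.length_eq ▸ hi)]
    simp
  · constructor
    · intro H
      by_contra hne
      have hpos : 0 < k + (decide (0 < j)).toNat := by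
        cases hd : decide (0 < j) <;> simp_all [Nat.pos_iff_ne_zero]
      have hlen : 0 < (splitBlock B k j).length := by
        rw [hsz]
        simp only [SlotState.step, ← h.length_eq]
        omega
      obtain ⟨x, hx⟩ := List.exists_mem_of_ne_nil _
        (ne_nil_of_mem_splitBlock h.ne_nil k j _ (List.getElem_mem hlen))
      rw [← List.getD_eq_getElem _ [] hlen] at hx
      exact H x (mem_flatten_of_mem_getD hx).2 ((hmem hx).2.1.2 hpos)
    · rintro ⟨rfl, hlo⟩ y hy
      obtain ⟨i, -, hi⟩ := exists_mem_getD_of_mem_flatten hy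
      rw [(hmem hi).2.1, hlo]
      simp

theorem goodCount_flatten (h : Represents st S B) {n : ℕ} (hn : B.flatten.length = n) :
    st.goodCount B.flatten = S.fillCount n (B.map List.length) := by
  induction n generalizing st S B with
  | zero => rw [List.length_eq_zero_iff.1 hn, ValueState.goodCount_nil, SlotState.fillCount]
  | succ n ih =>
    have hsum (l : List ℕ) (f : ℕ → ℕ) :
        (l.map f).sum = ∑ i ∈ Finset.range l.length, f (l.getD i 0) := by
      rw [Finset.sum_range, ← List.sum_ofFn]
      congr 1
      exact List.ext_getElem (by simp) (by simp)
    have hsum' (L : List (List ℕ)) (f : List ℕ → ℕ) :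
        (L.map f).sum = ∑ i ∈ Finset.range L.length, f (L.getD i []) := by
      rw [Finset.sum_range, ← List.sum_ofFn]
      congr 1
      exact List.ext_getElem (by simp) (by simp)
    rw [ValueState.goodCount_eq_sum st (h.sorted.imp ne_of_lt) (by rintro h0; simp [h0] at hn),
      List.map_flatten, List.sum_flatten, List.map_map, hsum', SlotState.fillCount, h.length_eq]
    refine Finset.sum_congr rfl fun k hk => ?_
    have hk : k < B.length := by simpa [h.length_eq] using hk
    have hlen : (B.map List.length).getD k 0 = (B.getD k []).length := by
      simp [List.getD_eq_getElem?_getD, hk]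
    rw [Function.comp_apply, hsum, hlen]
    refine Finset.sum_congr rfl fun j hj => ?_
    have hj : j < (B.getD k []).length := by simpa using hj
    have hperm := flatten_perm_cons_splitBlock hj
    have herase : (B.flatten.erase ((B.getD k []).getD j 0)).Perm (splitBlock B k j).flatten := by
      simpa only [List.erase_cons_head] using hperm.erase ((B.getD k []).getD j 0)
    rw [ValueState.ok_perm _ _ herase, ValueState.goodCount_perm _ herase, h.ok_iff hj]
    split_ifs
    · rw [ih (h.step hj) (by have := hperm.length_eq; simp only [List.length_cons] at this; omega),
        map_length_splitBlock hj]
    · rfl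

end Represents

theorem ncard_eq_count (n : ℕ) :
    Set.ncard {l : List ℕ | IsPermList l ∧ l.length = n + 1 ∧
      PAvoids l [4, 3, 2, 1] ∧ PAvoids l [1, 3, 2, 4]} =
    (SlotState.mk 1 0 0 0 0).count (n + 1) := by
  have hrep : Represents ValueState.initial (.mk 1 0 0 0 0) [List.range' 1 (n + 1)] := by
    refine ⟨rfl, by simp, ?_, ?_, ?_, ?_, ?_, fun _ => id⟩
    · simpa using List.pairwise_lt_range' (s := 1) (n := n + 1)
    all_goals simp [ValueState.initial, SlotState.ascBit]
  have h := hrep.goodCount_flatten (n := n + 1) (by simp)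
  have hcount : (SlotState.mk 1 0 0 0 0).count (n + 1) =
      (SlotState.mk 1 0 0 0 0).fillCount (n + 1) [n + 1] := by
    simp [SlotState.count, compSum, Finset.Nat.sum_antidiagonal_succ']
  rw [hcount, ← show [List.range' 1 (n + 1)].map List.length = [n + 1] by simp, ← h,
    ValueState.goodCount_eq_ncard]
  congr 1
  ext w
  simp only [Set.mem_ofPred_eq, good_initial_iff, List.flatten_singleton]
  have : w.Perm (List.range' 1 (n + 1)) ↔ IsPermList w ∧ w.length = n + 1 := by
    have hr : List.range' 1 (n + 1) = (List.range (n + 1)).map (· + 1) := by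
      rw [List.range'_eq_map_range]
      simp only [add_comm]
    rw [IsPermList, hr]
    constructor
    · intro hw
      have hl : w.length = n + 1 := by simpa using hw.length_eq
      exact ⟨by rwa [hl], hl⟩
    · rintro ⟨hw, hl⟩
      rwa [hl] at hw
  rw [this, and_assoc]

theorem ncard_length_zero :
    Set.ncard {l : List ℕ | IsPermList l ∧ l.length = 0 ∧
      PAvoids l [4, 3, 2, 1] ∧ PAvoids l [1, 3, 2, 4]} = 1 := by
  rw [Set.ncard_eq_one]
  refine ⟨[], ?_⟩
  ext w
  rw [Set.mem_ofPred_eq, ← good_initial_iff]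
  cases w <;> simp [ValueState.Good, IsPermList]

/-- the generating function `A(x)` for `Av(4321, 1324)` satisfies
`(1-x)^12 * A(x) = 1 - 11x + 56x^2 - 172x^3 + 357x^4 - 519x^5 + 554x^6 - 413x^7
+ 217x^8 - 83x^9 + 20x^10 - 2x^11`. -/
theorem stmt12 (a : ℕ → ℕ)
    (ha : ∀ n, a n = Set.ncard {l : List ℕ |
      IsPermList l ∧ l.length = n ∧ PAvoids l [4,3,2,1] ∧ PAvoids l [1,3,2,4]}) :
    ((1 - PowerSeries.X : PowerSeries ℤ) ^ 12) * PowerSeries.mk (fun n => (a n : ℤ)) =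
      1 - 11 * PowerSeries.X + 56 * PowerSeries.X ^ 2 - 172 * PowerSeries.X ^ 3
        + 357 * PowerSeries.X ^ 4 - 519 * PowerSeries.X ^ 5 + 554 * PowerSeries.X ^ 6
        - 413 * PowerSeries.X ^ 7 + 217 * PowerSeries.X ^ 8 - 83 * PowerSeries.X ^ 9
        + 20 * PowerSeries.X ^ 10 - 2 * PowerSeries.X ^ 11 := by
  refine SlotState.mul_mk_count_initial a ?_ fun n => ?_
  · rw [ha, ncard_length_zero]
  · rw [ha, ncard_eq_count]
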